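/- arXiv:math/9312205 — 4 statements merged into one kernel-verified Lean document; each statement's English description precedes it below -/
import Mathlib

section
/- Let n, ℓ ∈ ℕ with 1 ≤ ℓ ≤ n. Put ε_i = 1 for 1 ≤ i ≤ ℓ and ε_i = −1 for ℓ < i ≤ n. Suppose a real symmetric n×n matrix B = (b_ij), a vector a ∈ ℝⁿ, and a number c ∈ ℝ satisfy: for every choice of complex numbers s₁, …, s_n, the equality Σ_{i=1}^n (ε_i s_i² + a_i s_i) = 0 implies Σ_{i,j=1}^n b_ij s_i s_j + Σ_{i=1}^n c·a_i s_i = 0. Then B is a real constant multiple of the matrix I_ℓ. -/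
open MeasureTheory Matrix

noncomputable section

/-- The sign pattern: `1` for the first `ℓ` coordinates, `-1` for the rest. -/
def epsl (n ℓ : ℕ) (i : Fin n) : ℝ := if (i : ℕ) < ℓ then 1 else -1

/-- The diagonal matrix `I_ℓ` with the first `ℓ` diagonal entries `1`, the rest `-1`. -/
def Imat (n ℓ : ℕ) : Matrix (Fin n) (Fin n) ℝ := Matrix.diagonal (epsl n ℓ)

/-- The quadratic form `‖z‖_ℓ² = ∑_{i≤ℓ} z_i² - ∑_{i>ℓ} z_i²`. -/
def lnormSq (n ℓ : ℕ) (z : Fin n → ℝ) : ℝ := ∑ i, epsl n ℓ i * z i ^ 2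

/-- First partial derivative `∂f/∂x_i`. -/
def pd {n : ℕ} (f : (Fin n → ℝ) → ℝ) (i : Fin n) (x : Fin n → ℝ) : ℝ :=
  fderiv ℝ f x (Pi.single i 1)

/-- Second partial derivative `∂²f/∂x_i∂x_j`. -/
def pd2 {n : ℕ} (f : (Fin n → ℝ) → ℝ) (i j : Fin n) (x : Fin n → ℝ) : ℝ :=
  pd (pd f j) i x

/-- The differential operator `D_A f = ∑ a_ij ∂²f/∂x_i∂x_j + ∑ a_i ∂f/∂x_i`. -/
def DOp {n : ℕ} (A : Matrix (Fin n) (Fin n) ℝ) (a : Fin n → ℝ)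
    (f : (Fin n → ℝ) → ℝ) (x : Fin n → ℝ) : ℝ :=
  (∑ i, ∑ j, A i j * pd2 f i j x) + ∑ i, a i * pd f i x

/-- `L^p_{D_A}(E)`: real `C²` solutions of `D_A f = 0` on `E` with finite `L^p(E)` norm. -/
def SolSpace {n : ℕ} (A : Matrix (Fin n) (Fin n) ℝ) (a : Fin n → ℝ)
    (E : Set (Fin n → ℝ)) (p : ℝ) : Set ((Fin n → ℝ) → ℝ) :=
  {f | ContDiffOn ℝ 2 f E ∧ (∀ x ∈ E, DOp A a f x = 0) ∧
    IntegrableOn (fun x => |f x| ^ p) E volume}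

/-- A bounded domain: a nonempty bounded connected open set. -/
def IsBoundedDomain {n : ℕ} (E : Set (Fin n → ℝ)) : Prop :=
  IsOpen E ∧ IsConnected E ∧ Bornology.IsBounded E

/-- `S₁` embeds isometrically (as a linear subspace, with the `L^p` norms over `E₁`, `E₂`)
into `S₂`: there is a linear norm-preserving map from `S₁` into `S₂`. -/
def IsometricallyEmbeds {n : ℕ} (p : ℝ) (E₁ E₂ : Set (Fin n → ℝ))
    (S₁ S₂ : Set ((Fin n → ℝ) → ℝ)) : Prop :=
  ∃ T : ((Fin n → ℝ) → ℝ) → ((Fin n → ℝ) → ℝ),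
    (∀ f ∈ S₁, T f ∈ S₂) ∧
    (∀ f ∈ S₁, ∀ g ∈ S₁, T (f + g) = T f + T g) ∧
    (∀ (c : ℝ), ∀ f ∈ S₁, T (c • f) = c • T f) ∧
    (∀ f ∈ S₁, ∫ x in E₂, |T f x| ^ p = ∫ x in E₁, |f x| ^ p)

/-- The Jacobi matrix `J(x)` of a mapping `τ : ℝⁿ → ℝⁿ` at `x`. -/
def jacobiMatrix {n : ℕ} (τ : (Fin n → ℝ) → (Fin n → ℝ)) (x : Fin n → ℝ) :
    Matrix (Fin n) (Fin n) ℝ :=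
  Matrix.of fun i j => fderiv ℝ τ x (Pi.single j 1) i

/-- An `ℓ`-similarity: the composition of a homothety and an affine map preserving
the metric `‖·‖_ℓ²`, i.e. `z ↦ t • L z + v` with `Lᵀ I_ℓ L = I_ℓ`. -/
def IsLSimilarity (n ℓ : ℕ) (τ : (Fin n → ℝ) → (Fin n → ℝ)) : Prop :=
  ∃ (t : ℝ) (L : Matrix (Fin n) (Fin n) ℝ) (v : Fin n → ℝ),
    Lᵀ * Imat n ℓ * L = Imat n ℓ ∧ τ = fun z => t • L.mulVec z + v

/-- The `ℓ`-inversion with center `z₀`: `z ↦ (z-z₀)/‖z-z₀‖_ℓ² + z₀`. -/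
def lInversion (n ℓ : ℕ) (z₀ : Fin n → ℝ) (z : Fin n → ℝ) : Fin n → ℝ :=
  (lnormSq n ℓ (z - z₀))⁻¹ • (z - z₀) + z₀

/-- The domains `E₁` and `E₂` coincide up to the `C¹` mapping `τ : E₂ → cl E₁`,
i.e. `m(E₁ \ τ(E₂)) = 0`. -/
def CoincideUpTo {n : ℕ} (E₁ E₂ : Set (Fin n → ℝ))
    (τ : (Fin n → ℝ) → (Fin n → ℝ)) : Prop :=
  ContDiffOn ℝ 1 τ E₂ ∧ τ '' E₂ ⊆ closure E₁ ∧ volume (E₁ \ τ '' E₂) = 0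

/-- Two-variable case, with a nonzero first linear coefficient. -/
theorem pair_ne (e f p q r a b c : ℝ) (he : e = 1 ∨ e = -1) (hf : f = 1 ∨ f = -1)
    (h : ∀ x y : ℂ, (e : ℂ) * x ^ 2 + f * y ^ 2 + a * x + b * y = 0 →
      (p : ℂ) * x ^ 2 + 2 * r * x * y + q * y ^ 2 + c * (a * x + b * y) = 0)
    (ha : a ≠ 0) : r = 0 ∧ p * e = q * f := by
  -- off the zero sets, `B(v) = c Q(v)`
  have key : ∀ x y : ℝ, e * x ^ 2 + f * y ^ 2 ≠ 0 → a * x + b * y ≠ 0 →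
      p * x ^ 2 + 2 * r * x * y + q * y ^ 2 = c * (e * x ^ 2 + f * y ^ 2) := by
    intro x y hQ hA
    obtain ⟨Q, hQd⟩ : ∃ Q, Q = e * x ^ 2 + f * y ^ 2 := ⟨_, rfl⟩
    obtain ⟨A, hAd⟩ : ∃ A, A = a * x + b * y := ⟨_, rfl⟩
    rw [← hQd] at hQ ⊢
    rw [← hAd] at hA
    obtain ⟨t, ht⟩ : ∃ t, t = -A / Q := ⟨_, rfl⟩
    have htQ : t * Q = -A := by rw [ht]; field_simp
    have ht0 : t ≠ 0 := by
      rintro rfl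
      apply hA
      linarith
    have h1 := h ((t * x : ℝ) : ℂ) ((t * y : ℝ) : ℂ) (by
      norm_cast
      have : e * (t * x) ^ 2 + f * (t * y) ^ 2 + a * (t * x) + b * (t * y)
          = t * (t * Q + A) := by rw [hQd, hAd]; ring
      rw [this, htQ]; ring)
    norm_cast at h1
    have h2 : t ^ 2 * (p * x ^ 2 + 2 * r * x * y + q * y ^ 2 - c * Q) = 0 := by
      have : t ^ 2 * c * Q = - (t * c * A) := by linear_combination t * c * htQ
      have h3 : A * t * c = c * (a * (t * x) + b * (t * y)) := by rw [hAd]; ring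
      push_cast at h1
      linear_combination h1 - this + h3
    rcases mul_eq_zero.1 h2 with h3 | h3
    · exact absurd h3 (pow_ne_zero 2 ht0)
    · linarith
  have hp := key 1 0 (by rcases he with rfl | rfl <;> norm_num) (by simpa using ha)
  have hgood : ∀ x : ℝ, 1 + |b / a| < x →
      2 * r * x + q = c * f := by
    intro x hx
    have hb := abs_nonneg (b / a)
    have hx1 : 1 < x ^ 2 := by nlinarith
    have := key x 1 (by
      rcases he with rfl | rfl <;> rcases hf with rfl | rfl <;> intro h0 <;> nlinarith) (by
      intro h0
      have h5 : x = - (b / a) := by field_simp; linarith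
      have h6 := neg_le_abs (b / a)
      linarith)
    linear_combination this - x ^ 2 * hp
  have g1 := hgood (2 + |b / a|) (by linarith)
  have g2 := hgood (3 + |b / a|) (by linarith)
  have hr : r = 0 := by linarith
  refine ⟨hr, ?_⟩
  subst hr
  have hp' : p = c * e := by linarith
  have hq' : q = c * f := by linarith
  rw [hp', hq']
  rcases he with rfl | rfl <;> rcases hf with rfl | rfl <;> ring

/-- Two-variable case. -/
theorem pair_all (e f p q r a b c : ℝ) (he : e = 1 ∨ e = -1) (hf : f = 1 ∨ f = -1)
    (h : ∀ x y : ℂ, (e : ℂ) * x ^ 2 + f * y ^ 2 + a * x + b * y = 0 →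
      (p : ℂ) * x ^ 2 + 2 * r * x * y + q * y ^ 2 + c * (a * x + b * y) = 0) :
    r = 0 ∧ p * e = q * f := by
  by_cases ha : a = 0
  · by_cases hb : b = 0
    · subst ha hb
      have main : ∀ z : ℂ, z ≠ 0 → (e : ℂ) * z ^ 2 + f = 0 →
          (r = 0 ∧ (p : ℂ) * z ^ 2 + q = 0) := by
        intro z hz h0
        have h1 := h z 1 (by simpa using h0)
        have h2 := h (-z) 1 (by simpa using h0)
        push_cast at h1 h2
        constructor
        · have h3 : (r : ℂ) * z = 0 := by linear_combination (h1 - h2) / 4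
          rcases mul_eq_zero.1 h3 with h4 | h4
          · exact_mod_cast h4
          · exact absurd h4 hz
        · linear_combination (h1 + h2) / 2
      rcases he with rfl | rfl <;> rcases hf with rfl | rfl
      · obtain ⟨h1, h2⟩ := main Complex.I Complex.I_ne_zero (by simp)
        simp only [Complex.I_sq] at h2
        norm_cast at h2
        exact ⟨h1, by push_cast at h2; linarith⟩
      · obtain ⟨h1, h2⟩ := main 1 one_ne_zero (by simp)
        norm_cast at h2
        exact ⟨h1, by push_cast at h2; linarith⟩
      · obtain ⟨h1, h2⟩ := main 1 one_ne_zero (by simp)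
        norm_cast at h2
        exact ⟨h1, by push_cast at h2; linarith⟩
      · obtain ⟨h1, h2⟩ := main Complex.I Complex.I_ne_zero (by simp)
        simp only [Complex.I_sq] at h2
        norm_cast at h2
        exact ⟨h1, by push_cast at h2; linarith⟩
    · have := pair_ne f e q p r b a c hf he (fun x y h0 => by
        linear_combination h y x (by linear_combination h0)) hb
      exact ⟨this.1, this.2.symm⟩
  · exact pair_ne e f p q r a b c he hf h ha

theorem epsl_cases (n ℓ : ℕ) (i : Fin n) : epsl n ℓ i = 1 ∨ epsl n ℓ i = -1 := by
  unfold epsl; split_ifs <;> simp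

/-- Lemma 3: if for every `s ∈ ℂⁿ`, `∑ (ε_i s_i² + a_i s_i) = 0` implies
`∑ b_ij s_i s_j + ∑ c a_i s_i = 0`, then `B` is a real constant multiple of `I_ℓ`. -/
theorem statement10 (n ℓ : ℕ) (hℓ1 : 1 ≤ ℓ) (hℓn : ℓ ≤ n)
    (B : Matrix (Fin n) (Fin n) ℝ) (hB : B.IsSymm)
    (a : Fin n → ℝ) (c : ℝ)
    (h : ∀ s : Fin n → ℂ,
      (∑ i, ((epsl n ℓ i : ℂ) * s i ^ 2 + (a i : ℂ) * s i)) = 0 →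
      (∑ i, ∑ j, (B i j : ℂ) * s i * s j) + ∑ i, (c : ℂ) * (a i : ℂ) * s i = 0) :
    ∃ t : ℝ, B = t • Imat n ℓ := by
  have pair : ∀ i j : Fin n, i ≠ j →
      B i j = 0 ∧ B i i * epsl n ℓ i = B j j * epsl n ℓ j := by
    intro i j hij
    have hji : B j i = B i j := hB.apply i j
    refine pair_all _ _ _ _ _ (a i) (a j) c (epsl_cases n ℓ i) (epsl_cases n ℓ j) ?_
    intro x y h0
    have red : ∀ (F : Fin n → ℂ), (∀ k, k ≠ i → k ≠ j → F k = 0) →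
        ∑ k, F k = F i + F j := by
      intro F hF
      rw [← Finset.sum_pair hij]
      symm
      apply Finset.sum_subset (Finset.subset_univ _)
      intro k _ hk
      simp only [Finset.mem_insert, Finset.mem_singleton, not_or] at hk
      exact hF k hk.1 hk.2
    obtain ⟨s, hs⟩ : ∃ s : Fin n → ℂ, s = fun k => if k = i then x else if k = j then y else 0 :=
      ⟨_, rfl⟩
    have hsi : s i = x := by simp [hs]
    have hsj : s j = y := by simp [hs, hij.symm]
    have hsk : ∀ k, k ≠ i → k ≠ j → s k = 0 := by
      intro k h1 h2
      simp [hs, h1, h2]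
    have h1 := h s (by
      rw [red _ (fun k h1 h2 => by simp [hsk k h1 h2]), hsi, hsj]
      linear_combination h0)
    rw [red _ (fun k h1 h2 => by simp [hsk k h1 h2]),
      red _ (fun k h1 h2 => by simp [hsk k h1 h2]),
      red _ (fun k h1 h2 => by simp [hsk k h1 h2]),
      red _ (fun k h1 h2 => by simp [hsk k h1 h2]), hsi, hsj, hji] at h1
    linear_combination h1
  have hsq : ∀ i, epsl n ℓ i * epsl n ℓ i = 1 := by
    intro i
    rcases epsl_cases n ℓ i with h | h <;> rw [h] <;> norm_num
  let i0 : Fin n := ⟨0, by omega⟩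
  refine ⟨B i0 i0 * epsl n ℓ i0, ?_⟩
  ext i j
  by_cases hij : i = j
  · subst hij
    have hd : B i0 i0 * epsl n ℓ i0 = B i i * epsl n ℓ i := by
      by_cases h0 : i0 = i
      · rw [h0]
      · exact (pair i0 i h0).2
    simp only [Imat, Matrix.smul_apply, Matrix.diagonal_apply_eq, smul_eq_mul]
    rw [hd, mul_assoc, hsq, mul_one]
  · simp [Imat, Matrix.diagonal_apply_ne _ hij, (pair i j hij).1]
end
end

section
/- Let n ≥ 3, 1 ≤ ℓ ≤ n, put ε_i = 1 for 1 ≤ i ≤ ℓ and ε_i = −1 for ℓ < i ≤ n, let x₀ ∈ ℝⁿ and k ∈ ℝ. Define F(x) = k·(‖x−x₀‖_ℓ²)^{(2−n)/2} and, for m = 1, …, n, u_m(x) = (x₀)_m + (x_m − (x₀)_m)/‖x−x₀‖_ℓ² (the coordinate functions of the ℓ-inversion with center x₀). Then for every index m and every x with ‖x−x₀‖_ℓ² ≠ 0 (and ‖x−x₀‖_ℓ² > 0 when n is such that the power is defined), Σ_{i=1}^n ε_i (2 (∂F/∂x_i)(x)(∂u_m/∂x_i)(x) + F(x)(∂²u_m/∂x_i²)(x))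 = 0. -/
open MeasureTheory Matrix

noncomputable section

lemma hasFDerivAt_q (n ℓ : ℕ) (x₀ x : Fin n → ℝ) :
    HasFDerivAt (fun x => lnormSq n ℓ (x - x₀))
      (∑ j, (2 * epsl n ℓ j * (x j - x₀ j)) • ContinuousLinearMap.proj (R := ℝ) (φ := fun _ : Fin n => ℝ) j) x := by
  unfold lnormSq
  apply HasFDerivAt.fun_sum
  intro j _
  have h1 : HasFDerivAt (fun y : Fin n → ℝ => y j - x₀ j)
      (ContinuousLinearMap.proj (R := ℝ) (φ := fun _ : Fin n => ℝ) j) x :=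
    (hasFDerivAt_apply j x).sub_const _
  have h2 := (h1.pow 2).const_mul (epsl n ℓ j)
  refine h2.congr_fderiv ?_
  ext v
  simp
  ring

lemma q_apply (n ℓ : ℕ) (x₀ x : Fin n → ℝ) (i : Fin n) :
    (∑ j, (2 * epsl n ℓ j * (x j - x₀ j)) • ContinuousLinearMap.proj (R := ℝ) (φ := fun _ : Fin n => ℝ) j)
      (Pi.single i 1) = 2 * epsl n ℓ i * (x i - x₀ i) := by
  simp [ContinuousLinearMap.sum_apply, Pi.single_apply]

lemma epsl_sq (n ℓ : ℕ) (i : Fin n) : epsl n ℓ i * epsl n ℓ i = 1 := by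
  unfold epsl; split_ifs <;> norm_num

lemma hasFDerivAt_coord (n : ℕ) (x₀ x : Fin n → ℝ) (j : Fin n) :
    HasFDerivAt (fun y : Fin n → ℝ => y j - x₀ j)
      (ContinuousLinearMap.proj (R := ℝ) (φ := fun _ : Fin n => ℝ) j) x :=
  (hasFDerivAt_apply j x).sub_const _

lemma pd_u (n ℓ : ℕ) (x₀ x : Fin n → ℝ) (m i : Fin n) (hx : lnormSq n ℓ (x - x₀) ≠ 0) :
    pd (fun x => x₀ m + (x m - x₀ m) / lnormSq n ℓ (x - x₀)) i x =
      (if m = i then 1 else 0) * (lnormSq n ℓ (x - x₀))⁻¹ -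
        2 * epsl n ℓ i * ((x m - x₀ m) * (x i - x₀ i)) * (lnormSq n ℓ (x - x₀) ^ 2)⁻¹ := by
  have h := ((hasFDerivAt_coord n x₀ x m).mul
    ((hasDerivAt_inv hx).comp_hasFDerivAt x (hasFDerivAt_q n ℓ x₀ x))).const_add (x₀ m)
  unfold pd
  have h' := h.fderiv
  simp only [Function.comp_def, ← div_eq_mul_inv] at h'
  erw [h']
  simp only [_root_.add_apply, _root_.smul_apply, q_apply, smul_eq_mul,
    ContinuousLinearMap.proj_apply, Pi.single_apply]
  split_ifs <;> ring

lemma pd2_u (n ℓ : ℕ) (x₀ x : Fin n → ℝ) (m i : Fin n) (hx : lnormSq n ℓ (x - x₀) ≠ 0) :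
    pd2 (fun x => x₀ m + (x m - x₀ m) / lnormSq n ℓ (x - x₀)) i i x =
      - (if m = i then 1 else 0) * (4 * epsl n ℓ i * (x i - x₀ i)) * (lnormSq n ℓ (x - x₀) ^ 2)⁻¹
       - 2 * epsl n ℓ i * (x m - x₀ m) * (lnormSq n ℓ (x - x₀) ^ 2)⁻¹
       + 8 * (x m - x₀ m) * (x i - x₀ i) ^ 2 * (lnormSq n ℓ (x - x₀) ^ 3)⁻¹ := by
  have hev : pd (fun x => x₀ m + (x m - x₀ m) / lnormSq n ℓ (x - x₀)) i =ᶠ[nhds x]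
      fun x => (if m = i then 1 else 0) * (lnormSq n ℓ (x - x₀))⁻¹ -
        2 * epsl n ℓ i * ((x m - x₀ m) * (x i - x₀ i)) * (lnormSq n ℓ (x - x₀) ^ 2)⁻¹ := by
    filter_upwards [(hasFDerivAt_q n ℓ x₀ x).continuousAt.eventually_ne hx] with y hy
    exact pd_u n ℓ x₀ y m i hy
  have hq := hasFDerivAt_q n ℓ x₀ x
  have h1 := ((hasDerivAt_inv hx).comp_hasFDerivAt x hq).const_mul (if m = i then (1:ℝ) else 0)
  have h2 := (((hasFDerivAt_coord n x₀ x m).mul (hasFDerivAt_coord n x₀ x i)).const_mul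
    (2 * epsl n ℓ i)).mul ((hasDerivAt_inv (pow_ne_zero 2 hx)).comp_hasFDerivAt x (hq.pow 2))
  have h' := (h1.sub h2).fderiv
  unfold pd2
  rw [pd, hev.fderiv_eq]
  erw [h']
  simp only [_root_.add_apply, _root_.sub_apply, _root_.smul_apply, q_apply, smul_eq_mul,
    ContinuousLinearMap.proj_apply, Pi.single_apply, nsmul_eq_mul, Function.comp_def, Pi.mul_apply]
  have he := epsl_sq n ℓ i
  generalize epsl n ℓ i = e at *
  clear h' h1 h2 hq hev
  by_cases hmi : m = i
  · subst hmi
    simp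
    field_simp
    have he2 : e ^ 2 = 1 := by rw [pow_two, he]
    ring_nf
    simp only [he2]
    ring
  · simp [hmi]
    field_simp
    have he2 : e ^ 2 = 1 := by rw [pow_two, he]
    ring_nf
    simp only [he2]
    ring

lemma pd_F (n ℓ : ℕ) (x₀ x : Fin n → ℝ) (k p : ℝ) (i : Fin n) (hx : lnormSq n ℓ (x - x₀) ≠ 0) :
    pd (fun x => k * (lnormSq n ℓ (x - x₀)) ^ p) i x =
      k * (p * lnormSq n ℓ (x - x₀) ^ (p - 1) * (2 * epsl n ℓ i * (x i - x₀ i))) := by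
  have h := (((hasFDerivAt_q n ℓ x₀ x).rpow_const (p := p) (Or.inl hx)).const_mul k).fderiv
  unfold pd
  erw [h]
  simp only [_root_.smul_apply, q_apply, smul_eq_mul]

/-- for `F(x) = k ‖x-x₀‖_ℓ^{2-n}` and the coordinate functions `u_m` of the
`ℓ`-inversion with center `x₀`, one has
`∑ ε_i (2 ∂F/∂x_i ∂u_m/∂x_i + F ∂²u_m/∂x_i²) = 0` wherever `‖x-x₀‖_ℓ² > 0`. -/
theorem statement15 {n : ℕ} (hn : 3 ≤ n)
    (ℓ : ℕ) (hℓ1 : 1 ≤ ℓ) (hℓn : ℓ ≤ n)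
    (x₀ : Fin n → ℝ) (k : ℝ)
    (F : (Fin n → ℝ) → ℝ)
    (hF : F = fun x => k * (lnormSq n ℓ (x - x₀)) ^ (((2 : ℝ) - (n : ℝ)) / 2))
    (u : Fin n → (Fin n → ℝ) → ℝ)
    (hu : u = fun m x => x₀ m + (x m - x₀ m) / lnormSq n ℓ (x - x₀)) :
    ∀ (m : Fin n) (x : Fin n → ℝ), 0 < lnormSq n ℓ (x - x₀) →
      ∑ i, epsl n ℓ i * (2 * pd F i x * pd (u m) i x + F x * pd2 (u m) i i x) = 0 := by
  intro m x hx
  have hx0 := hx.ne'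
  subst hF hu
  simp only [pd_F n ℓ x₀ x k _ _ hx0, pd_u n ℓ x₀ x m _ hx0, pd2_u n ℓ x₀ x m _ hx0]
  rw [Real.rpow_sub_one hx0]
  have hq : lnormSq n ℓ (x - x₀) = ∑ i, epsl n ℓ i * (x i - x₀ i) ^ 2 := rfl
  generalize lnormSq n ℓ (x - x₀) = q at *
  set P := q ^ ((2 - (n:ℝ)) / 2)
  have key : ∀ i, epsl n ℓ i * (2 * (k * ((2 - (n:ℝ)) / 2 * (P / q) * (2 * epsl n ℓ i * (x i - x₀ i)))) *
      ((if m = i then 1 else 0) * q⁻¹ - 2 * epsl n ℓ i * ((x m - x₀ m) * (x i - x₀ i)) * (q ^ 2)⁻¹) +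
      k * P * (-(if m = i then 1 else 0) * (4 * epsl n ℓ i * (x i - x₀ i)) * (q ^ 2)⁻¹ -
        2 * epsl n ℓ i * (x m - x₀ m) * (q ^ 2)⁻¹ + 8 * (x m - x₀ m) * (x i - x₀ i) ^ 2 * (q ^ 3)⁻¹))
      = (if m = i then (-2 * n * k * P * (q ^ 2)⁻¹) * (x i - x₀ i) else 0)
        + (4 * n * k * P * (x m - x₀ m) * (q ^ 3)⁻¹) * (epsl n ℓ i * (x i - x₀ i) ^ 2)
        + -2 * k * P * (x m - x₀ m) * (q ^ 2)⁻¹ := by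
    intro i
    have he := epsl_sq n ℓ i
    generalize epsl n ℓ i = e at *
    have he2 : e ^ 2 = 1 := by rw [pow_two, he]
    have he3 : e ^ 3 = e := by rw [pow_succ, he2, one_mul]
    split_ifs with hmi
    · subst hmi
      field_simp
      ring_nf
      simp only [he2, he3]
      ring
    · field_simp
      ring_nf
      simp only [he2, he3]
      ring
  rw [Finset.sum_congr rfl (fun i _ => key i)]
  rw [Finset.sum_add_distrib, Finset.sum_add_distrib, ← Finset.mul_sum, ← hq]
  simp only [Finset.sum_ite_eq, Finset.mem_univ, if_true, Finset.sum_const, Finset.card_univ,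
    Fintype.card_fin, nsmul_eq_mul]
  field_simp
  ring
end
end

section
/- Let n ≥ 3, 1 ≤ ℓ ≤ n, p > 0, d ∈ ℝⁿ, and let G = D_ℓ + Σ_{i=1}^n d_i ∂/∂x_i. Let x₀ ∈ ℝⁿ, k ≠ 0, and define F(x) = k·(‖x−x₀‖_ℓ²)^{−n/p} on a nonempty open set U ⊂ ℝⁿ on which ‖x−x₀‖_ℓ² > 0. If G F = 0 on U, then p = 2n/(n−2) and d = 0. -/
open MeasureTheory Matrix

noncomputable section

lemma hasFDerivAt_Q (n ℓ : ℕ) (x₀ x : Fin n → ℝ) :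
    HasFDerivAt (fun x => lnormSq n ℓ (x - x₀))
      (∑ i, (epsl n ℓ i * (2 * (x i - x₀ i))) •
        (ContinuousLinearMap.proj (R := ℝ) (φ := fun _ : Fin n => ℝ) i)) x := by
  unfold lnormSq
  refine HasFDerivAt.fun_sum fun i _ => ?_
  have h1 : HasFDerivAt (fun x : Fin n → ℝ => x i - x₀ i)
      (ContinuousLinearMap.proj (R := ℝ) (φ := fun _ : Fin n => ℝ) i) x :=
    (hasFDerivAt_apply i x).sub_const _
  have h2 := (h1.pow 2).const_mul (epsl n ℓ i)
  refine h2.congr_fderiv ?_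
  ext v
  simp
  ring

lemma sum_proj_single {n : ℕ} (c : Fin n → ℝ) (j : Fin n) :
    (∑ i, c i • (ContinuousLinearMap.proj (R := ℝ) (φ := fun _ : Fin n => ℝ) i))
      (Pi.single j 1) = c j := by
  simp [Pi.single_apply]

lemma hasFDerivAt_Qpow (n ℓ : ℕ) (x₀ x : Fin n → ℝ) (k a : ℝ)
    (hx : 0 < lnormSq n ℓ (x - x₀)) :
    HasFDerivAt (fun x => k * lnormSq n ℓ (x - x₀) ^ a)
      ((k * (a * lnormSq n ℓ (x - x₀) ^ (a - 1))) •
      (∑ i, (epsl n ℓ i * (2 * (x i - x₀ i))) •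
        (ContinuousLinearMap.proj (R := ℝ) (φ := fun _ : Fin n => ℝ) i))) x := by
  have h := ((hasFDerivAt_Q n ℓ x₀ x).rpow_const (p := a) (Or.inl hx.ne')).const_mul k
  refine h.congr_fderiv ?_
  rw [smul_smul]

lemma pd_Qpow (n ℓ : ℕ) (x₀ x : Fin n → ℝ) (k a : ℝ)
    (hx : 0 < lnormSq n ℓ (x - x₀)) (j : Fin n) :
    pd (fun x => k * lnormSq n ℓ (x - x₀) ^ a) j x =
      (k * a) * lnormSq n ℓ (x - x₀) ^ (a - 1) * (epsl n ℓ j * (2 * (x j - x₀ j))) := by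
  unfold pd
  rw [(hasFDerivAt_Qpow n ℓ x₀ x k a hx).fderiv, _root_.smul_apply,
    sum_proj_single, smul_eq_mul]
  ring

lemma pd2_Qpow (n ℓ : ℕ) (x₀ x : Fin n → ℝ) (k a : ℝ) (U : Set (Fin n → ℝ)) (hU : IsOpen U)
    (hUpos : ∀ x ∈ U, 0 < lnormSq n ℓ (x - x₀)) (hx : x ∈ U) (j : Fin n) :
    pd2 (fun x => k * lnormSq n ℓ (x - x₀) ^ a) j j x =
      2 * (k * a) * lnormSq n ℓ (x - x₀) ^ (a - 1 - 1) *
        (2 * (a - 1) * (x j - x₀ j) ^ 2 + lnormSq n ℓ (x - x₀) * epsl n ℓ j) := by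
  have hev : pd (fun x => k * lnormSq n ℓ (x - x₀) ^ a) j =ᶠ[nhds x] fun x =>
      ((k * a) * lnormSq n ℓ (x - x₀) ^ (a - 1)) * (epsl n ℓ j * (2 * (x j - x₀ j))) := by
    filter_upwards [hU.mem_nhds hx] with y hy
    exact pd_Qpow n ℓ x₀ y k a (hUpos y hy) j
  have h1 : HasFDerivAt (fun x : Fin n → ℝ => x j - x₀ j)
      (ContinuousLinearMap.proj (R := ℝ) (φ := fun _ : Fin n => ℝ) j) x :=
    (hasFDerivAt_apply j x).sub_const _
  have h2 := (h1.const_mul 2).const_mul (epsl n ℓ j)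
  have h3 := (hasFDerivAt_Qpow n ℓ x₀ x (k * a) (a - 1) (hUpos x hx)).fun_mul h2
  have hp : lnormSq n ℓ (x - x₀) ^ (a - 1) =
      lnormSq n ℓ (x - x₀) ^ (a - 1 - 1) * lnormSq n ℓ (x - x₀) := by
    rw [← Real.rpow_add_one (hUpos x hx).ne']; ring_nf
  unfold pd2
  rw [pd, hev.fderiv_eq, h3.fderiv]
  simp only [_root_.add_apply, _root_.smul_apply, sum_proj_single,
    smul_eq_mul, ContinuousLinearMap.proj_apply, Pi.single_eq_same]
  rw [hp]
  linear_combination (4 * (k * a) * lnormSq n ℓ (x - x₀) ^ (a - 1 - 1) * (a - 1) *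
    (x j - x₀ j) ^ 2) * epsl_sq n ℓ j

lemma DOp_Qpow (n ℓ : ℕ) (x₀ x : Fin n → ℝ) (k a : ℝ) (U : Set (Fin n → ℝ)) (hU : IsOpen U)
    (hUpos : ∀ x ∈ U, 0 < lnormSq n ℓ (x - x₀)) (hx : x ∈ U) (d : Fin n → ℝ) :
    DOp (Imat n ℓ) d (fun x => k * lnormSq n ℓ (x - x₀) ^ a) x =
      2 * (k * a) * lnormSq n ℓ (x - x₀) ^ (a - 1) *
        (2 * (a - 1) + n + ∑ i, (d i * epsl n ℓ i) * (x i - x₀ i)) := by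
  have hp : lnormSq n ℓ (x - x₀) ^ (a - 1) =
      lnormSq n ℓ (x - x₀) ^ (a - 1 - 1) * lnormSq n ℓ (x - x₀) := by
    rw [← Real.rpow_add_one (hUpos x hx).ne']; ring_nf
  have hA : ∀ i, ∑ j, Imat n ℓ i j * pd2 (fun x => k * lnormSq n ℓ (x - x₀) ^ a) i j x =
      2 * (k * a) * lnormSq n ℓ (x - x₀) ^ (a - 1 - 1) * (2 * (a - 1)) *
        (epsl n ℓ i * (x - x₀) i ^ 2) + 2 * (k * a) * lnormSq n ℓ (x - x₀) ^ (a - 1) := by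
    intro i
    rw [Finset.sum_eq_single i]
    · rw [pd2_Qpow n ℓ x₀ x k a U hU hUpos hx, Imat, Matrix.diagonal_apply_eq, hp, Pi.sub_apply]
      linear_combination (2 * (k * a) * lnormSq n ℓ (x - x₀) ^ (a - 1 - 1) *
        lnormSq n ℓ (x - x₀)) * epsl_sq n ℓ i
    · intro j _ hj
      rw [Imat, Matrix.diagonal_apply_ne _ hj.symm, zero_mul]
    · simp
  unfold DOp
  rw [Finset.sum_congr rfl fun i _ => hA i, Finset.sum_add_distrib, ← Finset.mul_sum]
  have hQ : ∑ i, epsl n ℓ i * (x - x₀) i ^ 2 = lnormSq n ℓ (x - x₀) := rfl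
  have hB : ∑ i, d i * pd (fun x => k * lnormSq n ℓ (x - x₀) ^ a) i x =
      2 * (k * a) * lnormSq n ℓ (x - x₀) ^ (a - 1) *
        ∑ i, (d i * epsl n ℓ i) * (x i - x₀ i) := by
    rw [Finset.mul_sum]
    refine Finset.sum_congr rfl fun i _ => ?_
    rw [pd_Qpow n ℓ x₀ x k a (hUpos x hx)]
    ring
  rw [hQ, hB, hp]
  simp only [Finset.sum_const, Finset.card_univ, Fintype.card_fin, nsmul_eq_mul]
  ring

/-- if `F(x) = k ‖x-x₀‖_ℓ^{-2n/p}` (with `k ≠ 0`) satisfies `G F = 0` on a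
nonempty open set `U` where `‖x-x₀‖_ℓ² > 0`, `G = D_ℓ + ∑ d_i ∂/∂x_i`, then
`p = 2n/(n-2)` and `d = 0`. -/
theorem statement16 {n : ℕ} (hn : 3 ≤ n)
    (ℓ : ℕ) (hℓ1 : 1 ≤ ℓ) (hℓn : ℓ ≤ n)
    (p : ℝ) (hp : 0 < p) (d : Fin n → ℝ)
    (x₀ : Fin n → ℝ) (k : ℝ) (hk : k ≠ 0)
    (U : Set (Fin n → ℝ)) (hU : IsOpen U) (hUne : U.Nonempty)
    (hUpos : ∀ x ∈ U, 0 < lnormSq n ℓ (x - x₀))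
    (F : (Fin n → ℝ) → ℝ)
    (hF : F = fun x => k * (lnormSq n ℓ (x - x₀)) ^ (-(n : ℝ) / p))
    (hsol : ∀ x ∈ U, DOp (Imat n ℓ) d F x = 0) :
    p = 2 * (n : ℝ) / ((n : ℝ) - 2) ∧ d = 0 := by
  have hn' : (3 : ℝ) ≤ n := by exact_mod_cast hn
  have ha : -(n : ℝ) / p ≠ 0 := div_ne_zero (by linarith) hp.ne'
  have key : ∀ x ∈ U, 2 * (-(n : ℝ) / p - 1) + n +
      ∑ i, (d i * epsl n ℓ i) * (x i - x₀ i) = 0 := by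
    intro x hx
    have h := hsol x hx
    rw [hF, DOp_Qpow n ℓ x₀ x k _ U hU hUpos hx] at h
    have hq := (Real.rpow_pos_of_pos (hUpos x hx) (-(n : ℝ) / p - 1)).ne'
    exact (mul_eq_zero.mp h).resolve_left
      (mul_ne_zero (mul_ne_zero two_ne_zero (mul_ne_zero hk ha)) hq)
  obtain ⟨x, hx⟩ := hUne
  have hd : d = 0 := by
    have hder : HasFDerivAt (fun x : Fin n → ℝ => 2 * (-(n : ℝ) / p - 1) + n +
        ∑ i, (d i * epsl n ℓ i) * (x i - x₀ i))
        (∑ i, (d i * epsl n ℓ i) •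
        (ContinuousLinearMap.proj (R := ℝ) (φ := fun _ : Fin n => ℝ) i)) x := by
      refine HasFDerivAt.const_add _ (HasFDerivAt.fun_sum fun i _ => ?_)
      exact ((hasFDerivAt_apply (𝕜 := ℝ) i x).sub_const _).const_mul _
    have hev : (fun x : Fin n → ℝ => 2 * (-(n : ℝ) / p - 1) + n +
        ∑ i, (d i * epsl n ℓ i) * (x i - x₀ i)) =ᶠ[nhds x] fun _ => (0 : ℝ) := by
      filter_upwards [hU.mem_nhds hx] with y hy using key y hy
    have h0 := hder.unique ((hasFDerivAt_const (0 : ℝ) x).congr_of_eventuallyEq hev)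
    funext i
    have h1 := sum_proj_single (fun i => d i * epsl n ℓ i) i
    rw [h0] at h1
    have h2 : d i * epsl n ℓ i = 0 := h1.symm
    calc d i = d i * epsl n ℓ i * epsl n ℓ i := by rw [mul_assoc, epsl_sq, mul_one]
      _ = 0 := by rw [h2, zero_mul]
  refine ⟨?_, hd⟩
  have h := key x hx
  simp only [hd, Pi.zero_apply, zero_mul, Finset.sum_const_zero, add_zero] at h
  have hn2 : (n : ℝ) - 2 ≠ 0 := by linarith
  rw [eq_div_iff hn2]
  field_simp at h
  linarith
end
end

section
/- (Extension Theorem of Plotkin and Hardin.) Let p > 0 be not an even integer, let (X₁, σ₁) and (X₂, σ₂) be finite measure spaces, let Y be a subspace of L_p(X₁, σ₁) containing the constant function 1(x) ≡ 1, and let T be a linear isometry from Y into L_p(X₂, σ₂). Then there exists a linear isometry T̃: L^p(X₁, Ω₀, σ₁) → L^p(X₂, σ₂) such that T̃ restricted to Y equals T, where Ω₀ is the minimal σ-algebra making all the functions from Y measurable. -/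
open MeasureTheory Matrix

noncomputable section

lemma ph_fd_congr {f g : ℝ → ℝ} (h : ∀ x, 0 < x → f x = g x) (n : ℕ) :
    ∀ x, 0 < x → (fwdDiff (1:ℝ))^[n] f x = (fwdDiff (1:ℝ))^[n] g x := by
  induction n with
  | zero => simpa using h
  | succ n ih =>
    intro x hx
    simp only [Function.iterate_succ_apply', fwdDiff]
    rw [ih x hx, ih (x+1) (by linarith)]

lemma ph_fd_deriv {f g : ℝ → ℝ} (h : ∀ x, 0 < x → HasDerivAt f (g x) x) (n : ℕ) :
    ∀ x, 0 < x → HasDerivAt ((fwdDiff (1:ℝ))^[n] f) ((fwdDiff (1:ℝ))^[n] g x) x := by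
  induction n with
  | zero => simpa using h
  | succ n ih =>
    intro x hx
    simp only [Function.iterate_succ_apply']
    have h1 := (ih (x+1) (by linarith)).comp_add_const x 1
    exact h1.sub (ih x hx)

lemma ph_fd_mvt (n : ℕ) : ∀ (q x : ℝ), 0 < x → ∃ y ∈ Set.Icc x (x + n),
    (fwdDiff (1:ℝ))^[n] (fun x => x ^ q) x = (∏ i ∈ Finset.range n, (q - i)) * y ^ (q - n) := by
  induction n with
  | zero => intro q x hx; exact ⟨x, by simp, by simp⟩
  | succ n ih =>
    intro q x hx
    have hd := ph_fd_deriv (f := fun x => x ^ q) (g := fun x => q * x ^ (q-1))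
      (fun x hx => Real.hasDerivAt_rpow_const (Or.inl hx.ne')) n
    obtain ⟨z, hz, hz'⟩ := exists_hasDerivAt_eq_slope _ _ (show x < x + 1 by linarith)
      (fun y hy => (hd y (by linarith [hy.1])).continuousAt.continuousWithinAt)
      (fun y hy => hd y (by linarith [hy.1]))
    obtain ⟨y, hy, hy'⟩ := ih (q-1) z (by linarith [hz.1])
    refine ⟨y, ⟨by linarith [hz.1, hy.1], by push_cast; linarith [hz.2, hy.2]⟩, ?_⟩
    have e : (fwdDiff (1:ℝ))^[n] (fun x => q * x ^ (q-1)) z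
        = q * (fwdDiff (1:ℝ))^[n] (fun x => x ^ (q-1)) z := by
      have := fwdDiff_iter_const_smul (h := (1:ℝ)) q (fun x : ℝ => x ^ (q-1)) n
      exact congrFun this z
    simp only [Function.iterate_succ_apply']
    rw [fwdDiff]
    have : x + 1 - x = 1 := by ring
    rw [this, div_one] at hz'
    rw [← hz', e, hy', Finset.prod_range_succ']
    have : q - 1 - (n:ℝ) = q - ((n+1 : ℕ):ℝ) := by push_cast; ring
    rw [this]
    have : ∏ k ∈ Finset.range n, (q - ((k+1:ℕ):ℝ)) = ∏ k ∈ Finset.range n, (q - 1 - (k:ℝ)) :=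
      Finset.prod_congr rfl (fun k _ => by push_cast; ring)
    rw [this]; push_cast; ring

lemma ph_fd_neg (f : ℝ → ℝ) (hf : ∀ x, f (-x) = f x) (n : ℕ) : ∀ x,
    (fwdDiff (1:ℝ))^[n] f (-x-n) = (-1)^n * (fwdDiff (1:ℝ))^[n] f x := by
  induction n with
  | zero => simpa using hf
  | succ n ih =>
    intro x
    simp only [Function.iterate_succ_apply', fwdDiff]
    have e1 : -x - ((n+1:ℕ):ℝ) + 1 = -x - n := by push_cast; ring
    have e2 : -x - ((n+1:ℕ):ℝ) = -(x+1) - n := by push_cast; ring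
    rw [e1, e2, ih, ih]; ring

/-- The `n`-th difference of `|x|^p`. -/
noncomputable def phPsi (p : ℝ) (n : ℕ) : ℝ → ℝ := (fwdDiff (1:ℝ))^[n] (fun x => |x| ^ p)

lemma phPsi_eq (p : ℝ) (n : ℕ) (x : ℝ) : phPsi p n x =
    ∑ k ∈ Finset.range (n+1), ((-1:ℝ)^(n-k) * n.choose k) * |x + k| ^ p := by
  rw [phPsi, fwdDiff_iter_eq_sum_shift]
  refine Finset.sum_congr rfl fun k _ => ?_
  simp

lemma phPsi_cont {p : ℝ} (hp : 0 < p) (n : ℕ) : Continuous (phPsi p n) := by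
  have : phPsi p n = fun x : ℝ => ∑ k ∈ Finset.range (n+1), ((-1:ℝ)^(n-k) * n.choose k) * |x + k| ^ p :=
    funext (phPsi_eq p n)
  rw [this]
  refine continuous_finsetSum _ fun k _ => continuous_const.mul ?_
  exact Continuous.rpow_const (by fun_prop) (fun _ => Or.inr hp.le)

lemma phPsi_pos {p : ℝ} {n : ℕ} {x : ℝ} (hx : 0 < x) : ∃ y ∈ Set.Icc x (x + n),
    phPsi p n x = (∏ i ∈ Finset.range n, (p - i)) * y ^ (p - n) := by
  rw [phPsi, ph_fd_congr (g := fun x => x ^ p) (fun x hx => by simp only [abs_of_pos hx]) n x hx]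
  exact ph_fd_mvt n p x hx

lemma phPsi_integrable {p : ℝ} (hp : 0 < p) {n : ℕ} (hn : p + 1 < n) :
    Integrable (phPsi p n) := by
  have key : Integrable (fun x : ℝ => phPsi p n (x - (n:ℝ)/2)) := by
    refine LocallyIntegrable.integrable_of_isBigO_atTop_of_norm_isNegInvariant
      (g := fun x : ℝ => (x - (n:ℝ)/2) ^ (p - n)) ?_ ?_ ?_ ?_
    · exact ((phPsi_cont hp n).comp (by fun_prop)).locallyIntegrable
    · refine Filter.Eventually.of_forall fun x => ?_
      simp only [Function.comp]
      have := ph_fd_neg (fun x => |x| ^ p) (by simp) n (x - n/2)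
      have e : -(x - (n:ℝ)/2) - n = -x - n/2 := by ring
      rw [e] at this
      simp [phPsi, this]
    · refine Asymptotics.IsBigO.of_bound |∏ i ∈ Finset.range n, (p - i)| ?_
      filter_upwards [Filter.eventually_gt_atTop ((n:ℝ)/2)] with x hx
      have hx' : 0 < x - n/2 := by linarith
      obtain ⟨y, hy, hy'⟩ := phPsi_pos (p := p) (n := n) hx'
      rw [hy', norm_mul, Real.norm_eq_abs, Real.norm_eq_abs, Real.norm_eq_abs]
      have hy0 : 0 < y := hx'.trans_le hy.1
      rw [abs_of_pos (Real.rpow_pos_of_pos hy0 _), abs_of_pos (Real.rpow_pos_of_pos hx' _)]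
      exact mul_le_mul_of_nonneg_left (Real.rpow_le_rpow_of_nonpos hx' hy.1 (by linarith))
        (abs_nonneg _)
    · refine ⟨Set.Ioi ((n:ℝ)/2 + 1), Filter.Ioi_mem_atTop _, ?_⟩
      have := (integrableOn_Ioi_rpow_of_lt (a := p - n) (by linarith) (c := 1) one_pos)
      have h2 := (measurePreserving_sub_right volume ((n:ℝ)/2)).integrableOn_comp_preimage
        (MeasurableEquiv.subRight ((n:ℝ)/2)).measurableEmbedding (f := fun x : ℝ => x ^ (p - n)) (s := Set.Ioi 1)
      have h3 := h2.2 this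
      have : (fun x => x - (n:ℝ)/2) ⁻¹' Set.Ioi 1 = Set.Ioi ((n:ℝ)/2 + 1) := by
        ext x; simp; constructor <;> intro h <;> linarith
      rw [this] at h3
      exact h3
  simpa using key.comp_add_right ((n:ℝ)/2)

lemma phPsi_ne {p : ℝ} (hp : 0 < p) (hpe : ∀ k : ℕ, p ≠ 2 * k) {n : ℕ} (hn : p + 1 < n) :
    ∃ x, phPsi p n x ≠ 0 := by
  by_cases hk : ∃ k : ℕ, p = k
  · obtain ⟨k, rfl⟩ := hk
    have hodd : Odd k := by
      rw [← Nat.not_even_iff_odd]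
      rintro ⟨m, hm⟩
      exact hpe m (by rw [hm]; push_cast; ring)
    have hkn : k < n := by
      have : (k:ℝ) < n := by linarith
      exact_mod_cast this
    have h0 : (fwdDiff (1:ℝ))^[n] (fun x : ℝ => x ^ k) = 0 := fwdDiff_iter_pow_eq_zero_of_lt hkn
    refine ⟨-1/2, ?_⟩
    have h1 := congrFun h0 (-1/2)
    rw [fwdDiff_iter_eq_sum_shift] at h1
    simp only [Pi.zero_apply] at h1
    rw [Finset.sum_range_succ'] at h1
    rw [phPsi_eq, Finset.sum_range_succ']
    have e : ∀ j : ℕ, |(-1/2:ℝ) + ((j+1:ℕ):ℝ)| ^ (k:ℝ) = (-1/2 + ((j+1:ℕ):ℝ)) ^ k := by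
      intro j
      rw [Real.rpow_natCast, abs_of_nonneg]
      push_cast
      have : (0:ℝ) ≤ j := Nat.cast_nonneg j
      linarith
    simp only [e]
    have e0 : |(-1/2:ℝ) + ((0:ℕ):ℝ)| ^ (k:ℝ) = - (-1/2 + ((0:ℕ):ℝ))^k := by
      rw [Real.rpow_natCast, ← hodd.neg_pow]
      congr 1
      norm_num
    rw [e0]
    simp only [zsmul_eq_mul, nsmul_eq_mul, mul_one, Int.cast_mul, Int.cast_pow, Int.cast_neg,
      Int.cast_one, Int.cast_natCast] at h1
    intro h
    have h3 : ((-1:ℝ) ^ (n-0) * (n.choose 0)) * (-1/2 + ((0:ℕ):ℝ))^k = 0 := by linarith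
    norm_num at h3
  · push Not at hk
    obtain ⟨y, hy, hy'⟩ := phPsi_pos (p := p) (n := n) one_pos
    refine ⟨1, ?_⟩
    rw [hy']
    refine mul_ne_zero (Finset.prod_ne_zero_iff.2 fun i _ => sub_ne_zero.2 (hk i)) ?_
    exact (Real.rpow_pos_of_pos (by linarith [hy.1]) _).ne'

/-- There is a nonzero frequency at which the Fourier transform does not vanish. -/
lemma phPsi_fourier {p : ℝ} (hp : 0 < p) (hpe : ∀ k : ℕ, p ≠ 2 * k) {n : ℕ} (hn : p + 1 < n) :
    ∃ s : ℝ, s ≠ 0 ∧ (∫ b : ℝ, (phPsi p n b : ℂ) * Complex.exp (b * s * Complex.I)) ≠ 0 := by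
  by_contra! hcon
  obtain ⟨x, hx⟩ := phPsi_ne hp hpe hn
  have hF : ∀ w : ℝ, w ≠ 0 → FourierTransform.fourier (fun b => (phPsi p n b : ℂ)) w = 0 := by
    intro w hw
    rw [Real.fourier_real_eq_integral_exp_smul]
    rw [← hcon (-2 * Real.pi * w) (by simp [Real.pi_ne_zero, hw])]
    refine integral_congr_ae (Filter.Eventually.of_forall fun b => ?_)
    simp only [smul_eq_mul]
    rw [mul_comm]
    congr 2
    push_cast; ring
  have hF' : (FourierTransform.fourier (fun b => (phPsi p n b : ℂ))) =ᵐ[volume] (fun _ : ℝ => (0:ℂ)) := by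
    have : ∀ᵐ w : ℝ, w ≠ 0 := by simp [ae_iff]
    filter_upwards [this] with w hw using hF w hw
  have hprodInt : Integrable (fun b => (phPsi p n b : ℂ)) := (phPsi_integrable hp hn).ofReal
  have h1 := Continuous.fourierInv_fourier_eq (f := fun b => (phPsi p n b : ℂ))
    (Complex.continuous_ofReal.comp (phPsi_cont hp n)) hprodInt
    ((integrable_zero ℝ ℂ volume).congr hF'.symm)
  have h2 := congrFun h1 x
  rw [Real.fourierInv_eq, integral_congr_ae (g := fun _ => (0:ℂ))] at h2
  · simp at h2; exact hx (by exact_mod_cast h2.symm)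
  · filter_upwards [hF'] with w hw
    rw [hw]; simp

lemma ph_fubini {ψ : ℝ → ℝ} (hc : Continuous ψ) (hi : Integrable ψ) (μ : Measure ℝ)
    [IsFiniteMeasure μ] (a s : ℝ) :
    ∫ b : ℝ, ((∫ x, ψ (a * x + b) ∂μ : ℝ) : ℂ) * Complex.exp (b * s * Complex.I) =
      charFun μ (-(a * s)) * ∫ b : ℝ, (ψ b : ℂ) * Complex.exp (b * s * Complex.I) := by
  have hexp : ∀ b : ℝ, ‖Complex.exp (b * s * Complex.I)‖ = 1 := by
    intro b
    have := Complex.norm_exp_ofReal_mul_I (b * s)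
    push_cast at this; exact this
  have hii : ∀ x : ℝ, Integrable (fun b : ℝ => (ψ (a * x + b) : ℂ) * Complex.exp (b * s * Complex.I)) := by
    intro x
    have h1 : Integrable (fun b : ℝ => (ψ (a * x + b) : ℂ)) := (hi.comp_add_left (a*x)).ofReal
    refine h1.mul_bdd (c := 1) ?_ ?_
    · exact Continuous.aestronglyMeasurable (by fun_prop)
    · exact Filter.Eventually.of_forall fun b => (hexp b).le
  have hprodInt : Integrable (Function.uncurry fun (b x : ℝ) =>
      (ψ (a * x + b) : ℂ) * Complex.exp (b * s * Complex.I)) (volume.prod μ) := by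
    rw [integrable_prod_iff']
    · refine ⟨Filter.Eventually.of_forall fun x => hii x, ?_⟩
      simp only [Function.uncurry, norm_mul, hexp, mul_one]
      have : ∀ x : ℝ, ∫ b : ℝ, ‖(ψ (a * x + b) : ℂ)‖ = ∫ b : ℝ, ‖(ψ b : ℂ)‖ := fun x =>
        integral_add_left_eq_self (fun b => ‖(ψ b : ℂ)‖) (a * x)
      simp only [this]
      exact integrable_const _
    · refine Continuous.aestronglyMeasurable ?_
      simp only [Function.uncurry_def]
      fun_prop
  calc _ = ∫ b : ℝ, ∫ x, (ψ (a * x + b) : ℂ) * Complex.exp (b * s * Complex.I) ∂μ := by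
        congr 1; ext b
        rw [integral_mul_const, integral_complex_ofReal]
    _ = ∫ x, (∫ b : ℝ, (ψ (a * x + b) : ℂ) * Complex.exp (b * s * Complex.I)) ∂μ :=
        integral_integral_swap hprodInt
    _ = ∫ x : ℝ, Complex.exp ((-(a * s) : ℝ) * x * Complex.I) *
          (∫ b : ℝ, (ψ b : ℂ) * Complex.exp (b * s * Complex.I)) ∂μ := by
        congr 1; ext x
        rw [← integral_const_mul, ← integral_add_left_eq_self (fun b : ℝ =>
          Complex.exp ((-(a * s) : ℝ) * x * Complex.I) *
            ((ψ b : ℂ) * Complex.exp (b * s * Complex.I))) (a * x)]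
        congr 1; ext b
        rw [mul_left_comm, ← Complex.exp_add]
        congr 2
        push_cast; ring
    _ = _ := by
        rw [integral_mul_const, charFun_apply_real]

/-- One-dimensional uniqueness theorem (Plotkin, Rudin). -/
lemma ph_one_dim {p : ℝ} (hp : 0 < p) (hpe : ∀ k : ℕ, p ≠ 2 * k) (μ ν : Measure ℝ)
    [IsFiniteMeasure μ] [IsFiniteMeasure ν] (hmass : μ Set.univ = ν Set.univ)
    (hμ : ∀ t, Integrable (fun x => |x + t| ^ p) μ) (hν : ∀ t, Integrable (fun x => |x + t| ^ p) ν)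
    (c : ℝ) (h : ∀ t, ∫ x, |x + t| ^ p ∂μ = ∫ x, |x + t| ^ p ∂ν + c) : μ = ν := by
  obtain ⟨n, hn⟩ := exists_nat_gt (p + 1)
  obtain ⟨s, hs, hΨ⟩ := phPsi_fourier hp hpe hn
  have hn0 : n ≠ 0 := by rintro rfl; norm_num at hn; linarith
  have hcomb : ∀ (m : Measure ℝ), (∀ t, Integrable (fun x => |x + t| ^ p) m) → ∀ a b : ℝ, a ≠ 0 →
      ∫ x, phPsi p n (a * x + b) ∂m = ∑ k ∈ Finset.range (n+1),
        ((-1:ℝ)^(n-k) * n.choose k) * (|a|^p * ∫ x, |x + (b + k)/a| ^ p ∂m) := by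
    intro m hm a b ha
    have e : ∀ (k : ℕ) (x : ℝ), |a * x + b + k| ^ p = |a| ^ p * |x + (b+k)/a| ^ p := by
      intro k x
      rw [← Real.mul_rpow (abs_nonneg _) (abs_nonneg _), ← abs_mul]
      congr 2; field_simp; ring
    simp only [phPsi_eq, e]
    rw [integral_finsetSum]
    · simp only [integral_const_mul]
    · intro k _
      exact ((hm _).const_mul _).const_mul _
  have hψ : ∀ a b : ℝ, a ≠ 0 → ∫ x, phPsi p n (a * x + b) ∂μ = ∫ x, phPsi p n (a * x + b) ∂ν := by
    intro a b ha
    rw [hcomb μ hμ a b ha, hcomb ν hν a b ha]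
    simp only [h, mul_add, Finset.sum_add_distrib]
    have : ∑ k ∈ Finset.range (n+1), ((-1:ℝ)^(n-k) * n.choose k) * (|a|^p * c) = 0 := by
      rw [← Finset.sum_mul]
      have h0 := add_pow (1:ℝ) (-1) n
      simp only [one_pow, one_mul, add_neg_cancel, zero_pow hn0] at h0
      rw [← h0, zero_mul]
    rw [this, add_zero]
  refine Measure.ext_of_charFun ?_
  ext ξ
  by_cases hξ : ξ = 0
  · subst hξ
    simp [charFun_zero, Measure.real, hmass]
  · have ha : -(ξ / s) ≠ 0 := neg_ne_zero.2 (div_ne_zero hξ hs)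
    have h1 := ph_fubini (phPsi_cont hp n) (phPsi_integrable hp hn) μ (-(ξ/s)) s
    have h2 := ph_fubini (phPsi_cont hp n) (phPsi_integrable hp hn) ν (-(ξ/s)) s
    simp only [hψ _ _ ha] at h1
    rw [h1] at h2
    have e : -(-(ξ / s) * s) = ξ := by field_simp
    rw [e] at h2
    exact mul_right_cancel₀ hΨ h2

lemma ph_pair {X₁ X₂ : Type*} [MeasurableSpace X₁] [MeasurableSpace X₂]
    (σ₁ : Measure X₁) (σ₂ ν : Measure X₂) [IsFiniteMeasure σ₁] [IsFiniteMeasure ν]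
    {p : ℝ} (hp : 0 < p) (hpe : ∀ k : ℕ, p ≠ 2 * k)
    (f : X₁ → ℝ) (hfm : Measurable f) (h w : X₂ → ℝ) (hhm : Measurable h) (hwm : Measurable w)
    (H1 : ∀ g : X₂ → ℝ, Integrable g ν ↔ Integrable (fun x => |h x| ^ p * g x) σ₂)
    (H2 : ∀ g : X₂ → ℝ, ∫ x, g x ∂ν = ∫ x, |h x| ^ p * g x ∂σ₂)
    (hmass : σ₁ Set.univ = ν Set.univ)
    (hf : ∀ t : ℝ, Integrable (fun x => |f x + t| ^ p) σ₁)
    (hw : ∀ t : ℝ, Integrable (fun x => |w x + t * h x| ^ p) σ₂)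
    (hiso : ∀ t : ℝ, ∫ x, |w x + t * h x| ^ p ∂σ₂ = ∫ x, |f x + t| ^ p ∂σ₁) :
    σ₁.map f = ν.map (fun x => w x / h x) ∧ ∀ᵐ x ∂σ₂, h x = 0 → w x = 0 := by
  have hvm : Measurable (fun x => w x / h x) := hwm.div hhm
  have hs : MeasurableSet {x | h x = 0} := hhm (measurableSet_singleton 0)
  set r : X₂ → ℝ := Set.indicator {x | h x = 0} (fun x => |w x| ^ p) with hr
  have hri : Integrable r σ₂ := by
    have := (hw 0).indicator hs
    simpa [hr] using this
  have hdec : ∀ t x, |w x + t * h x| ^ p = |h x| ^ p * |w x / h x + t| ^ p + r x := by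
    intro t x
    by_cases hx : h x = 0
    · simp [hr, hx, Real.zero_rpow hp.ne']
    · simp only [hr, Set.indicator, Set.mem_ofPred_eq, hx, if_false, add_zero]
      rw [← Real.mul_rpow (abs_nonneg _) (abs_nonneg _), ← abs_mul]
      congr 2; field_simp
  have hvi' : ∀ t, Integrable (fun x => |h x| ^ p * |w x / h x + t| ^ p) σ₂ := by
    intro t
    have := (hw t).sub hri
    refine this.congr (Filter.Eventually.of_forall fun x => ?_)
    simp only [Pi.sub_apply, hdec]; ring
  have hvi : ∀ t, Integrable (fun x => |w x / h x + t| ^ p) ν := fun t => (H1 _).2 (hvi' t)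
  have hmeas : ∀ t : ℝ, Measurable (fun x : ℝ => |x + t| ^ p) := by intro t; fun_prop
  have hiso2 : ∀ t : ℝ, ∫ x, |f x + t| ^ p ∂σ₁ = ∫ x, |w x / h x + t| ^ p ∂ν + ∫ x, r x ∂σ₂ := by
    intro t
    rw [← hiso, H2, ← integral_add (hvi' t) hri]
    simp only [hdec]
  have hmap1 : ∀ t : ℝ, ∫ x, |x + t| ^ p ∂(σ₁.map f) = ∫ x, |f x + t| ^ p ∂σ₁ := fun t =>
    integral_map hfm.aemeasurable (hmeas t).aestronglyMeasurable
  have hmap2 : ∀ t : ℝ, ∫ x, |x + t| ^ p ∂(ν.map (fun x => w x / h x))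
      = ∫ x, |w x / h x + t| ^ p ∂ν := fun t =>
    integral_map hvm.aemeasurable (hmeas t).aestronglyMeasurable
  have key : σ₁.map f = ν.map (fun x => w x / h x) := by
    refine ph_one_dim hp hpe _ _ ?_ ?_ ?_ (∫ x, r x ∂σ₂) ?_
    · rw [Measure.map_apply hfm MeasurableSet.univ, Measure.map_apply hvm MeasurableSet.univ]
      simpa using hmass
    · intro t
      exact (integrable_map_measure (hmeas t).aestronglyMeasurable hfm.aemeasurable).2 (hf t)
    · intro t
      exact (integrable_map_measure (hmeas t).aestronglyMeasurable hvm.aemeasurable).2 (hvi t)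
    · intro t
      rw [hmap1, hmap2, hiso2]
  refine ⟨key, ?_⟩
  have hr0 : ∫ x, r x ∂σ₂ = 0 := by
    have := hiso2 0
    rw [← hmap1, ← hmap2, key] at this
    linarith
  have hrn : 0 ≤ r := fun x => Set.indicator_nonneg (fun x _ => by positivity) x
  rw [integral_eq_zero_iff_of_nonneg hrn hri] at hr0
  filter_upwards [hr0] with x hx h0
  simp only [hr, Set.indicator, Set.mem_ofPred_eq, h0, if_true, Pi.zero_apply] at hx
  simpa using (Real.rpow_eq_zero (abs_nonneg _) hp.ne').1 hx

/-- Extension Theorem of Plotkin and Hardin: a linear isometry `T` from a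
subspace `Y ∋ 1` of `L_p(X₁,σ₁)` into `L_p(X₂,σ₂)` (`p > 0` not an even integer,
`σ₁`, `σ₂` finite) extends to a linear isometry `T'` of `L^p(X₁,Ω₀,σ₁)` into
`L^p(X₂,σ₂)`, where `Ω₀ = ⨆ f ∈ Y, comap f (borel ℝ)` is the minimal σ-algebra making
the functions of `Y` measurable. -/
theorem statement18 {X₁ X₂ : Type*} [MeasurableSpace X₁] [MeasurableSpace X₂]
    (σ₁ : Measure X₁) (σ₂ : Measure X₂) [IsFiniteMeasure σ₁] [IsFiniteMeasure σ₂]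
    (p : ℝ) (hp : 0 < p) (hpNotEven : ∀ k : ℕ, p ≠ 2 * k)
    (Y : Set (X₁ → ℝ))
    (hY1 : (fun _ => (1 : ℝ)) ∈ Y)
    (hYadd : ∀ f ∈ Y, ∀ g ∈ Y, f + g ∈ Y)
    (hYsmul : ∀ (c : ℝ), ∀ f ∈ Y, c • f ∈ Y)
    (hYmeas : ∀ f ∈ Y, Measurable f)
    (hYint : ∀ f ∈ Y, Integrable (fun x => |f x| ^ p) σ₁)
    (T : (X₁ → ℝ) → (X₂ → ℝ))
    (hTmeas : ∀ f ∈ Y, AEStronglyMeasurable (T f) σ₂)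
    (hTint : ∀ f ∈ Y, Integrable (fun x => |T f x| ^ p) σ₂)
    (hTadd : ∀ f ∈ Y, ∀ g ∈ Y, T (f + g) =ᵐ[σ₂] T f + T g)
    (hTsmul : ∀ (c : ℝ), ∀ f ∈ Y, T (c • f) =ᵐ[σ₂] c • T f)
    (hTiso : ∀ f ∈ Y, ∫ x, |T f x| ^ p ∂σ₂ = ∫ x, |f x| ^ p ∂σ₁) :
    ∃ T' : (X₁ → ℝ) → (X₂ → ℝ),
      (∀ g : X₁ → ℝ,
        Measurable[⨆ f ∈ Y, MeasurableSpace.comap f (borel ℝ)] g →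
        Integrable (fun x => |g x| ^ p) σ₁ →
        AEStronglyMeasurable (T' g) σ₂ ∧ Integrable (fun x => |T' g x| ^ p) σ₂ ∧
          ∫ x, |T' g x| ^ p ∂σ₂ = ∫ x, |g x| ^ p ∂σ₁) ∧
      (∀ g₁ g₂ : X₁ → ℝ,
        Measurable[⨆ f ∈ Y, MeasurableSpace.comap f (borel ℝ)] g₁ →
        Integrable (fun x => |g₁ x| ^ p) σ₁ →
        Measurable[⨆ f ∈ Y, MeasurableSpace.comap f (borel ℝ)] g₂ →
        Integrable (fun x => |g₂ x| ^ p) σ₁ →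
        T' (g₁ + g₂) =ᵐ[σ₂] T' g₁ + T' g₂) ∧
      (∀ (c : ℝ) (g : X₁ → ℝ),
        Measurable[⨆ f ∈ Y, MeasurableSpace.comap f (borel ℝ)] g →
        Integrable (fun x => |g x| ^ p) σ₁ →
        T' (c • g) =ᵐ[σ₂] c • T' g) ∧
      (∀ f ∈ Y, T' f =ᵐ[σ₂] T f) := by
  classical
  -- measurable representatives on `X₂`
  set one : X₁ → ℝ := fun _ => 1 with hone
  set h : X₂ → ℝ := (hTmeas one hY1).mk with hh
  have hhm : Measurable h := (hTmeas one hY1).stronglyMeasurable_mk.measurable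
  have hhT : T one =ᵐ[σ₂] h := (hTmeas one hY1).ae_eq_mk
  set w : Y → X₂ → ℝ := fun f => (hTmeas f f.2).mk with hw
  have hwm : ∀ f, Measurable (w f) := fun f => (hTmeas f f.2).stronglyMeasurable_mk.measurable
  have hwT : ∀ f : Y, T f =ᵐ[σ₂] w f := fun f => (hTmeas f f.2).ae_eq_mk
  set ρ : X₂ → NNReal := fun x => Real.toNNReal (|h x| ^ p) with hρ
  have hρm : Measurable ρ := by fun_prop
  have hρe : ∀ x, (ρ x : ℝ) = |h x| ^ p := fun x => Real.coe_toNNReal _ (by positivity)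
  set ν : Measure X₂ := σ₂.withDensity (fun x => (ρ x : ENNReal)) with hν
  have H1 : ∀ g : X₂ → ℝ, Integrable g ν ↔ Integrable (fun x => |h x| ^ p * g x) σ₂ := by
    intro g
    rw [hν, integrable_withDensity_iff_integrable_smul hρm]
    simp only [NNReal.smul_def, hρe, smul_eq_mul]
  have H2 : ∀ g : X₂ → ℝ, ∫ x, g x ∂ν = ∫ x, |h x| ^ p * g x ∂σ₂ := by
    intro g
    rw [hν, integral_withDensity_eq_integral_smul hρm]
    simp only [NNReal.smul_def, hρe, smul_eq_mul]
  have H3 : ∀ P : X₂ → Prop, (∀ᵐ x ∂ν, P x) → ∀ᵐ x ∂σ₂, h x ≠ 0 → P x := by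
    intro P hP
    rw [hν, ae_withDensity_iff (by fun_prop)] at hP
    filter_upwards [hP] with x hx h0
    apply hx
    have : (0:ℝ) < ρ x := by rw [hρe]; positivity
    simpa using (NNReal.coe_pos.1 this).ne'
  have H4 : ν ≪ σ₂ := withDensity_absolutelyContinuous _ _
  have hhi : Integrable (fun x => |h x| ^ p) σ₂ := by
    refine (hTint one hY1).congr ?_
    filter_upwards [hhT] with x hx
    rw [hx]
  have : IsFiniteMeasure ν := by
    have : Integrable (fun _ : X₂ => (1:ℝ)) ν := (H1 _).2 (by simpa using hhi)
    simpa using (integrable_const_iff.1 this)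
  have hmass : σ₁ Set.univ = ν Set.univ := by
    have h1 : ∫ _, (1:ℝ) ∂ν = ∫ _, (1:ℝ) ∂σ₁ := by
      rw [H2]
      have := hTiso one hY1
      simp only [hone, abs_one, Real.one_rpow] at this
      rw [← this]
      refine integral_congr_ae ?_
      filter_upwards [hhT] with x hx
      rw [mul_one, ← hx]
    simp only [integral_const, smul_eq_mul, mul_one, Measure.real] at h1
    exact ((ENNReal.toReal_eq_toReal_iff' (measure_ne_top _ _) (measure_ne_top _ _)).1 h1).symm
  -- the one-function statement
  have hpair : ∀ f : Y, σ₁.map f = ν.map (fun x => w f x / h x) ∧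
      ∀ᵐ x ∂σ₂, h x = 0 → w f x = 0 := by
    intro f
    have hmem : ∀ t : ℝ, (f : X₁ → ℝ) + t • one ∈ Y := fun t =>
      hYadd _ f.2 _ (hYsmul t _ hY1)
    have hTt : ∀ t : ℝ, T ((f : X₁ → ℝ) + t • one) =ᵐ[σ₂] fun x => w f x + t * h x := by
      intro t
      filter_upwards [hTadd _ f.2 _ (hYsmul t _ hY1), hTsmul t _ hY1, hwT f, hhT]
        with x h1 h2 h3 h4
      rw [h1, Pi.add_apply, h2, Pi.smul_apply, h3, h4, smul_eq_mul]
    refine ph_pair σ₁ σ₂ ν hp hpNotEven f (hYmeas f f.2) h (w f) hhm (hwm f) H1 H2 hmass ?_ ?_ ?_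
    · intro t
      simpa [hone] using hYint _ (hmem t)
    · intro t
      refine (hTint _ (hmem t)).congr ?_
      filter_upwards [hTt t] with x hx
      rw [hx]
    · intro t
      have h1 : ∫ x, |w f x + t * h x| ^ p ∂σ₂ = ∫ x, |T ((f : X₁ → ℝ) + t • one) x| ^ p ∂σ₂ := by
        refine integral_congr_ae ?_
        filter_upwards [hTt t] with x hx
        rw [hx]
      rw [h1, hTiso _ (hmem t)]
      simp [hone]
  -- linear combinations
  have hlin : ∀ (I : Finset Y) (c : Y → ℝ), ∃ hm : (∑ i ∈ I, c i • (i : X₁ → ℝ)) ∈ Y,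
      w ⟨_, hm⟩ =ᵐ[σ₂] fun x => ∑ i ∈ I, c i * w i x := by
    intro I c
    suffices hs : ∃ hm : (∑ i ∈ I, c i • (i : X₁ → ℝ)) ∈ Y,
        T (∑ i ∈ I, c i • (i : X₁ → ℝ)) =ᵐ[σ₂] fun x => ∑ i ∈ I, c i * w i x by
      obtain ⟨hm, hm'⟩ := hs
      exact ⟨hm, (hwT ⟨_, hm⟩).symm.trans hm'⟩
    induction I using Finset.induction_on with
    | empty =>
      have h0 : (0 : X₁ → ℝ) = (0:ℝ) • one := by simp
      refine ⟨by rw [Finset.sum_empty, h0]; exact hYsmul _ _ hY1, ?_⟩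
      rw [Finset.sum_empty, h0]
      filter_upwards [hTsmul 0 _ hY1] with x hx
      rw [hx]; simp
    | insert a s ha ih =>
      obtain ⟨hm, hm'⟩ := ih
      rw [Finset.sum_insert ha]
      refine ⟨hYadd _ (hYsmul _ _ a.2) _ hm, ?_⟩
      filter_upwards [hTadd _ (hYsmul (c a) _ a.2) _ hm, hTsmul (c a) _ a.2, hm', hwT a]
        with x h1 h2 h3 h4
      rw [h1, Pi.add_apply, h2, h3, Pi.smul_apply, h4, Finset.sum_insert ha, smul_eq_mul]
  -- joint maps
  set F : X₁ → (Y → ℝ) := fun x f => (f : X₁ → ℝ) x with hF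
  set G : X₂ → (Y → ℝ) := fun x f => w f x / h x with hG
  have hFm : Measurable F := measurable_pi_lambda _ fun f => hYmeas f f.2
  have hGm : Measurable G := measurable_pi_lambda _ fun f => (hwm f).div hhm
  have hjoint : σ₁.map F = ν.map G := by
    have hfin : ∀ I : Finset Y, (σ₁.map F).map I.restrict = (ν.map G).map I.restrict := by
      intro I
      have hIm : Measurable (I.restrict : (Y → ℝ) → (I → ℝ)) := Finset.measurable_restrict I
      refine Measure.ext_of_charFunDual ?_
      ext L
      have hLm : Measurable L := L.continuous.measurable
      rw [charFunDual_eq_charFun_map_one, charFunDual_eq_charFun_map_one,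
        Measure.map_map hIm hFm, Measure.map_map hIm hGm, Measure.map_map hLm (hIm.comp hFm),
        Measure.map_map hLm (hIm.comp hGm)]
      set c : Y → ℝ := fun i => if hi : i ∈ I then L (Pi.single ⟨i, hi⟩ 1) else 0 with hc
      have hL : ∀ y : Y → ℝ, L (I.restrict y) = ∑ i ∈ I, c i * y i := by
        intro y
        have := LinearMap.pi_apply_eq_sum_univ (L : (I → ℝ) →ₗ[ℝ] ℝ) (I.restrict y)
        rw [← Finset.sum_coe_sort]
        simp only [ContinuousLinearMap.coe_coe] at this
        rw [this]
        refine Finset.sum_congr rfl fun i _ => ?_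
        simp only [hc, i.2, dif_pos, Finset.restrict, smul_eq_mul]
        rw [mul_comm]
        congr 2
        ext j
        simp [Pi.single_apply, eq_comm]
      obtain ⟨hm, hm'⟩ := hlin I c
      have e1 : (L ∘ I.restrict ∘ F) = ∑ i ∈ I, c i • (i : X₁ → ℝ) := by
        ext x
        simp [hL, hF]
      have e2 : (L ∘ I.restrict ∘ G) =ᵐ[ν] fun x => w ⟨_, hm⟩ x / h x := by
        filter_upwards [H4.ae_le hm'] with x hx
        rw [hx]
        simp only [Function.comp, hL, hG, Finset.sum_div, mul_div_assoc]
      rw [e1, Measure.map_congr e2, (hpair ⟨_, hm⟩).1]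
    refine IsProjectiveLimit.unique (P := fun I => (σ₁.map F).map I.restrict) (fun I => rfl) ?_
    intro I
    exact (hfin I).symm
  have hae : ∀ P : (Y → ℝ) → Prop, (∀ᵐ y ∂(σ₁.map F), P y) → ∀ᵐ x ∂σ₂, h x ≠ 0 → P (G x) := by
    intro P hP
    rw [hjoint] at hP
    exact H3 _ (ae_of_ae_map hGm.aemeasurable hP)
  have hΩ : (⨆ f ∈ Y, MeasurableSpace.comap f (borel ℝ)) = MeasurableSpace.comap F inferInstance := by
    have : (inferInstance : MeasurableSpace (Y → ℝ)) = MeasurableSpace.pi := rfl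
    rw [this, MeasurableSpace.pi, MeasurableSpace.comap_iSup, iSup_subtype']
    refine iSup_congr fun f => ?_
    rw [MeasurableSpace.comap_comp, ← BorelSpace.measurable_eq (α := ℝ)]
    rfl
  rw [hΩ]
  have hfac : ∀ g : X₁ → ℝ, Measurable[MeasurableSpace.comap F inferInstance] g →
      ∃ φ : (Y → ℝ) → ℝ, Measurable φ ∧ g = φ ∘ F := fun g hg => hg.exists_eq_measurable_comp
  choose! Φ hΦm hΦ using hfac
  have hsub : ∀ f ∈ Y, Measurable[MeasurableSpace.comap F inferInstance] f := by
    intro f hf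
    have : f = (fun y : Y → ℝ => y ⟨f, hf⟩) ∘ F := rfl
    rw [this]
    exact (measurable_pi_apply _).comp (comap_measurable F)
  -- almost everywhere identities transfer
  have htrans : ∀ P : (Y → ℝ) → Prop, MeasurableSet {y | P y} → (∀ x, P (F x)) →
      ∀ᵐ x ∂σ₂, h x ≠ 0 → P (G x) := by
    intro P hPm hP
    refine hae P ?_
    rw [ae_map_iff hFm.aemeasurable hPm]
    exact Filter.Eventually.of_forall hP
  refine ⟨fun g x => h x * Φ g (G x), ?_, ?_, ?_, ?_⟩
  · intro g hg hgi
    have hm : Measurable fun x => h x * Φ g (G x) := hhm.mul ((hΦm g hg).comp hGm)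
    have hpm : Measurable fun y => |Φ g y| ^ p := by
      have := hΦm g hg
      fun_prop
    have e : ∀ x, |h x * Φ g (G x)| ^ p = |h x| ^ p * |Φ g (G x)| ^ p := fun x => by
      rw [abs_mul, Real.mul_rpow (abs_nonneg _) (abs_nonneg _)]
    have e2 : ∀ x, g x = Φ g (F x) := fun x => congrFun (hΦ g hg) x
    refine ⟨hm.aestronglyMeasurable, ?_, ?_⟩
    · simp only [e]
      refine (H1 (fun x => |Φ g (G x)| ^ p)).1 ?_
      have h1 : Integrable (fun y => |Φ g y| ^ p) (σ₁.map F) := by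
        refine (integrable_map_measure hpm.aestronglyMeasurable hFm.aemeasurable).2 ?_
        refine hgi.congr (Filter.Eventually.of_forall fun x => ?_)
        simp only [e2 x, Function.comp]
      rw [hjoint] at h1
      exact (integrable_map_measure hpm.aestronglyMeasurable hGm.aemeasurable).1 h1
    · simp only [e]
      rw [← H2 (fun x => |Φ g (G x)| ^ p),
        ← integral_map (f := fun y => |Φ g y| ^ p) hGm.aemeasurable hpm.aestronglyMeasurable,
        ← hjoint, integral_map hFm.aemeasurable hpm.aestronglyMeasurable]
      simp only [← e2]
  · intro g₁ g₂ hg₁ _ hg₂ _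
    have hg : Measurable[MeasurableSpace.comap F inferInstance] (g₁ + g₂) :=
      Measurable.add (m := MeasurableSpace.comap F inferInstance) hg₁ hg₂
    have := htrans (fun y => Φ (g₁ + g₂) y = Φ g₁ y + Φ g₂ y)
      (measurableSet_eq_fun (hΦm _ hg) ((hΦm _ hg₁).add (hΦm _ hg₂)))
      (fun x => by
        have h0 := congrFun (hΦ _ hg) x
        have h1 := congrFun (hΦ _ hg₁) x
        have h2 := congrFun (hΦ _ hg₂) x
        simp only [Function.comp, Pi.add_apply] at h0 h1 h2
        rw [← h0, ← h1, ← h2])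
    filter_upwards [this] with x hx
    by_cases h0 : h x = 0
    · simp [h0]
    · simp only [Pi.add_apply]
      rw [hx h0]; ring
  · intro c g hg₁ _
    have hg : Measurable[MeasurableSpace.comap F inferInstance] (c • g) :=
      Measurable.const_smul (m := MeasurableSpace.comap F inferInstance) hg₁ c
    have := htrans (fun y => Φ (c • g) y = c * Φ g y)
      (measurableSet_eq_fun (hΦm _ hg) ((hΦm _ hg₁).const_mul c))
      (fun x => by
        have h0 := congrFun (hΦ _ hg) x
        have h1 := congrFun (hΦ _ hg₁) x
        simp only [Function.comp, Pi.smul_apply, smul_eq_mul] at h0 h1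
        rw [← h0, ← h1])
    filter_upwards [this] with x hx
    by_cases h0 : h x = 0
    · simp [h0]
    · simp only [Pi.smul_apply, smul_eq_mul]
      rw [hx h0]; ring
  · intro f hf
    have := htrans (fun y => Φ f y = y ⟨f, hf⟩)
      (measurableSet_eq_fun (hΦm _ (hsub f hf)) (measurable_pi_apply _))
      (fun x => (congrFun (hΦ _ (hsub f hf)) x).symm)
    filter_upwards [this, (hpair ⟨f, hf⟩).2, hwT ⟨f, hf⟩] with x h1 h2 h3
    rw [h3]
    by_cases h0 : h x = 0
    · rw [h2 h0, h0, zero_mul]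
    · rw [h1 h0, hG]
      field_simp
end
end
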